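/- Let k be a nonnegative integer and n a positive integer. Then (3^{2k+1} + 1)/4 · E_{2k} ≡ ∑_{r=0}^{n-1} (-1)^{n-1-r} C(k-1-r, n-1-r) C(k, r) (3^{2r+1} + 1)/4 · E_{2r} (mod 2^{3n}), where the congruence is between rational numbers whose denominators are odd (equivalently, their difference is 2^{3n} times a rational number with odd denominator), and C(a, b) denotes the binomial coefficient extended to possibly negative integer upper argument a. -/

import Mathlib

/-- The Euler numbers `E n`, defined by `E 0 = 1`, `E (2n-1) = 0` for `n ≥ 1`,
and `∑_{r=0}^{n} C(2n, 2r) * E (2r) = 0` for `n ≥ 1`. -/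
def eulerE : ℕ → ℤ
  | 0 => 1
  | 1 => 0
  | n + 2 =>
      if Even n then
        -∑ r ∈ (Finset.range (n / 2 + 1)).attach,
          ((n + 2).choose (2 * r.1) : ℤ) * eulerE (2 * r.1)
      else 0
  decreasing_by
    have := r.2
    simp only [Finset.mem_range] at this
    omega

/-- The binomial coefficient $\binom{a}{n}$ extended to a possibly negative
integer upper argument $a$. -/
def ichoose (a : ℤ) (n : ℕ) : ℤ :=
  if 0 ≤ a then (a.toNat.choose n : ℤ) else (-1) ^ n * ((n - a - 1).toNat.choose n : ℤ)

open PowerSeries in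
/-- The exponential generating function of the Euler numbers. -/
noncomputable def eulerSeries : ℚ⟦X⟧ :=
  PowerSeries.mk fun n => (eulerE n : ℚ) / n.factorial

open PowerSeries in
/-- The exponential generating function of `(3 ^ (m + 1) + 1) / 4 * eulerE m`. -/
noncomputable def regularizedEulerSeries : ℚ⟦X⟧ :=
  PowerSeries.C (1 / 4) * (eulerSeries + 3 * rescale 3 eulerSeries)

/-- The linear functional on `ℚ[X]` with moments `(3 ^ (m + 1) + 1) / 4 * eulerE m`. -/
noncomputable def eulerFunctional : Polynomial ℚ →ₗ[ℚ] ℚ :=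
  Polynomial.lsum fun m => (m.factorial * PowerSeries.coeff m regularizedEulerSeries) • LinearMap.id

/-- The even polynomial `x ↦ choose ((x - 1) / 2 + i) (2 * i)`. -/
noncomputable def centralChoose (i : ℕ) : Polynomial ℚ :=
  Polynomial.C (1 / ((2 * i).factorial : ℚ)) *
    (descPochhammer ℚ (2 * i)).comp
      (Polynomial.C (1 / 2) * (Polynomial.X - 1) + Polynomial.C (i : ℚ))

theorem eulerE_odd (n : ℕ) : eulerE (2 * n + 1) = 0 := by
  cases n with
  | zero => simp [eulerE]
  | succ n =>
    rw [show 2 * (n + 1) + 1 = (2 * n + 1) + 2 by ring, eulerE, if_neg (by simp)]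

theorem sum_choose_mul_eulerE (n : ℕ) (hn : n ≠ 0) :
    ∑ r ∈ Finset.range (n + 1), ((2 * n).choose (2 * r) : ℤ) * eulerE (2 * r) = 0 := by
  obtain ⟨n, rfl⟩ := Nat.exists_eq_succ_of_ne_zero hn
  rw [Finset.sum_range_succ, Nat.choose_self]
  conv_lhs => rw [show 2 * n.succ = 2 * n + 2 by rw [Nat.succ_eq_add_one]; ring]
  conv_lhs => arg 2; rw [eulerE]
  rw [if_pos (by simp), Nat.mul_div_cancel_left _ two_pos,
    Finset.sum_attach (Finset.range (n + 1))
      (fun r => ((2 * n + 2).choose (2 * r) : ℤ) * eulerE (2 * r))]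
  simp

theorem sum_range_two_mul_succ {M : Type*} [AddCommMonoid M] (g : ℕ → M) (n : ℕ) :
    ∑ j ∈ Finset.range (2 * n + 1), g j =
      ∑ r ∈ Finset.range (n + 1), g (2 * r) + ∑ r ∈ Finset.range n, g (2 * r + 1) := by
  induction n with
  | zero => simp
  | succ n ih =>
    rw [show 2 * (n + 1) + 1 = 2 * n + 1 + 1 + 1 by ring, Finset.sum_range_succ,
      Finset.sum_range_succ, ih, Finset.sum_range_succ (fun r => g (2 * r)) (n + 1),
      Finset.sum_range_succ (fun r => g (2 * r + 1)) n, mul_add_one]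
    abel

open PowerSeries in
theorem eulerSeries_mul_exp_add :
    eulerSeries * (exp ℚ + evalNegHom (exp ℚ)) = 2 := by
  ext m
  have h2 : (2 : ℚ⟦X⟧) = PowerSeries.C 2 := (map_ofNat PowerSeries.C 2).symm
  rw [h2, coeff_C, coeff_mul,
    Finset.Nat.sum_antidiagonal_eq_sum_range_succ
      (fun i j => coeff i eulerSeries * coeff j (exp ℚ + evalNegHom (exp ℚ)))]
  simp only [eulerSeries, coeff_mk, map_add, evalNegHom, coeff_rescale, coeff_exp]
  rcases Nat.even_or_odd' m with ⟨n, rfl | rfl⟩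
  · rw [sum_range_two_mul_succ]
    have hodd : ∑ r ∈ Finset.range n, (eulerE (2 * r + 1) : ℚ) / ((2 * r + 1).factorial : ℚ) *
        (algebraMap ℚ ℚ (1 / ((2 * n - (2 * r + 1)).factorial : ℚ)) +
          (-1) ^ (2 * n - (2 * r + 1)) *
            algebraMap ℚ ℚ (1 / ((2 * n - (2 * r + 1)).factorial : ℚ))) = 0 :=
      Finset.sum_eq_zero fun r _ => by simp [eulerE_odd]
    rw [hodd, add_zero]
    rcases eq_or_ne n 0 with rfl | hn
    · norm_num [eulerE]
    rw [if_neg (by omega)]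
    have key := congrArg (fun z : ℤ => 2 / ((2 * n).factorial : ℚ) * (z : ℚ))
      (sum_choose_mul_eulerE n hn)
    simp only [Int.cast_zero, mul_zero, Int.cast_sum, Finset.mul_sum] at key
    rw [← key]
    refine Finset.sum_congr rfl fun r hr => ?_
    have hle : 2 * r ≤ 2 * n := by have := Finset.mem_range.1 hr; omega
    have heven : Even (2 * n - 2 * r) := by rw [← Nat.mul_sub]; exact even_two_mul _
    rw [heven.neg_one_pow]
    push_cast [Nat.cast_choose ℚ hle]
    have h1 : ((2 * n).factorial : ℚ) ≠ 0 := by positivity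
    field_simp
    ring
  · rw [if_neg (by omega)]
    refine Finset.sum_eq_zero fun j hj => ?_
    have hj' := Finset.mem_range.1 hj
    rcases Nat.even_or_odd' j with ⟨r, rfl | rfl⟩
    · have hodd : Odd (2 * n + 1 - 2 * r) := ⟨n - r, by omega⟩
      simp [hodd.neg_one_pow]
    · simp [eulerE_odd]

open PowerSeries in
theorem regularizedEulerSeries_mul :
    regularizedEulerSeries * (rescale 2 (exp ℚ) + rescale (-2) (exp ℚ) - 1) =
      PowerSeries.C (1 / 2) * (exp ℚ + rescale (-1) (exp ℚ)) := by
  have hS := eulerSeries_mul_exp_add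
  have hab := exp_mul_exp_neg_eq_one (A := ℚ)
  have hS3 := congrArg (rescale (3 : ℚ)) hS
  have ha2 : rescale (2 : ℚ) (exp ℚ) = exp ℚ ^ 2 := by
    rw [exp_pow_eq_rescale_exp]; norm_num
  have ha3 : rescale (3 : ℚ) (exp ℚ) = exp ℚ ^ 3 := by
    rw [exp_pow_eq_rescale_exp]; norm_num
  have hb : evalNegHom (exp ℚ) = rescale (-1) (exp ℚ) := rfl
  have hb2 : rescale (-2 : ℚ) (exp ℚ) = rescale (-1) (exp ℚ) ^ 2 := by
    rw [← map_pow, exp_pow_eq_rescale_exp, rescale_rescale]; norm_num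
  have hb3 : rescale (3 : ℚ) (rescale (-1) (exp ℚ)) = rescale (-1) (exp ℚ) ^ 3 := by
    rw [← map_pow, exp_pow_eq_rescale_exp, rescale_rescale, rescale_rescale]; norm_num
  rw [hb] at hS hab hS3
  rw [map_mul, map_add, ha3, hb3, map_ofNat] at hS3
  rw [ha2, hb2, regularizedEulerSeries]
  generalize rescale (-1) (exp ℚ) = b at *
  generalize exp ℚ = a at *
  generalize rescale 3 eulerSeries = s at *
  have h2 : (2 : ℚ⟦X⟧) = PowerSeries.C 2 := (map_ofNat PowerSeries.C 2).symm
  have hne : a + b ≠ 0 := fun h => by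
    rw [h, mul_zero] at hS
    rw [h2] at hS
    simpa using congrArg PowerSeries.constantCoeff hS
  have h42 : (PowerSeries.C (1 / 2 : ℚ)) = 2 * PowerSeries.C (1 / 4) := by
    rw [h2, ← map_mul]; norm_num
  rw [h42]
  apply mul_right_cancel₀ hne
  linear_combination PowerSeries.C (1 / 4) * ((a ^ 2 + b ^ 2 - 1) * hS + 3 * hS3) +
    PowerSeries.C (1 / 4) * (3 * s * (a + b) - 4) * hab

theorem eulerFunctional_X_pow (m : ℕ) :
    eulerFunctional (Polynomial.X ^ m) =
      m.factorial * PowerSeries.coeff m regularizedEulerSeries := by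
  simp [eulerFunctional, Polynomial.lsum_apply, Polynomial.X_pow_eq_monomial,
    Polynomial.sum_monomial_index]

theorem eulerFunctional_X_pow_eq (m : ℕ) :
    eulerFunctional (Polynomial.X ^ m) = (3 ^ (m + 1) + 1) / 4 * eulerE m := by
  have h3 : (3 : PowerSeries ℚ) = PowerSeries.C 3 := (map_ofNat PowerSeries.C 3).symm
  rw [eulerFunctional_X_pow, regularizedEulerSeries, PowerSeries.coeff_C_mul, map_add, h3,
    PowerSeries.coeff_C_mul, PowerSeries.coeff_rescale, eulerSeries, PowerSeries.coeff_mk]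
  have h1 : (m.factorial : ℚ) ≠ 0 := by positivity
  field_simp
  ring

theorem eulerFunctional_X_add_C_pow (a : ℚ) (m : ℕ) :
    eulerFunctional ((Polynomial.X + Polynomial.C a) ^ m) =
      m.factorial * PowerSeries.coeff m
        (regularizedEulerSeries * PowerSeries.rescale a (PowerSeries.exp ℚ)) := by
  rw [PowerSeries.coeff_mul, Finset.Nat.sum_antidiagonal_eq_sum_range_succ
      (fun i j => PowerSeries.coeff i regularizedEulerSeries *
        PowerSeries.coeff j (PowerSeries.rescale a (PowerSeries.exp ℚ))),
    add_pow, map_sum, Finset.mul_sum]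
  refine Finset.sum_congr rfl fun j hj => ?_
  have hle : j ≤ m := Nat.lt_succ_iff.1 (Finset.mem_range.1 hj)
  have : (Polynomial.X ^ j * Polynomial.C a ^ (m - j) * (m.choose j : Polynomial ℚ)) =
      (a ^ (m - j) * m.choose j) • Polynomial.X ^ j := by
    rw [Polynomial.smul_eq_C_mul]
    simp
    ring
  rw [this, map_smul, eulerFunctional_X_pow, PowerSeries.coeff_rescale, PowerSeries.coeff_exp,
    Nat.cast_choose ℚ hle]
  have h1 : (j.factorial : ℚ) ≠ 0 := by positivity
  simp
  field_simp

theorem eulerFunctional_taylor (p : Polynomial ℚ) :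
    eulerFunctional (p.taylor 2) + eulerFunctional (p.taylor (-2)) - eulerFunctional p =
      (p.eval 1 + p.eval (-1)) / 2 := by
  induction p using Polynomial.induction_on' with
  | add p q hp hq =>
    simp only [map_add, Polynomial.eval_add]
    linear_combination hp + hq
  | monomial m c =>
    have h := congrArg (fun F => (m.factorial : ℚ) * PowerSeries.coeff m F)
      regularizedEulerSeries_mul
    simp only [mul_sub, mul_add, map_add, map_sub, mul_one, PowerSeries.coeff_C_mul,
      PowerSeries.coeff_rescale, PowerSeries.coeff_exp] at h
    rw [← eulerFunctional_X_add_C_pow, ← eulerFunctional_X_add_C_pow,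
      ← eulerFunctional_X_pow] at h
    have h1 : (m.factorial : ℚ) ≠ 0 := by positivity
    rw [← mul_one c, ← smul_eq_mul, ← Polynomial.smul_monomial,
      ← Polynomial.X_pow_eq_monomial]
    simp only [map_smul, Polynomial.taylor_X_pow, Polynomial.eval_smul, Polynomial.eval_pow,
      Polynomial.eval_X, smul_eq_mul]
    simp only [Algebra.algebraMap_self, RingHom.id_apply] at h
    field_simp at h ⊢
    linear_combination c * h

theorem centralChoose_eval (i : ℕ) (x : ℚ) :
    (centralChoose i).eval x =
      1 / ((2 * i).factorial : ℚ) * (descPochhammer ℚ (2 * i)).eval ((x - 1) / 2 + i) := by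
  rw [show (x - 1) / 2 + (i : ℚ) = 1 / 2 * (x - 1) + i by ring]
  simp only [centralChoose, Polynomial.eval_comp, Polynomial.eval_mul, Polynomial.eval_C,
    Polynomial.eval_add, Polynomial.eval_sub, Polynomial.eval_X, Polynomial.eval_one]

theorem centralChoose_zero : centralChoose 0 = 1 := by simp [centralChoose]

theorem factorial_two_mul_succ (i : ℕ) :
    ((2 * (i + 1)).factorial : ℚ) = (2 * i + 2) * (2 * i + 1) * (2 * i).factorial := by
  rw [mul_add_one, Nat.factorial_succ, Nat.factorial_succ]
  push_cast
  ring

theorem descPochhammer_eval_sub_one (n : ℕ) (x : ℚ) :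
    (descPochhammer ℚ (n + 1)).eval (x - 1) =
      (descPochhammer ℚ (n + 1)).eval x - (n + 1) * (descPochhammer ℚ n).eval (x - 1) := by
  simpa [Polynomial.eval_comp] using
    congrArg (Polynomial.eval x) (descPochhammer_succ_comp_X_sub_one ℚ n)

theorem centralChoose_second_difference (i : ℕ) :
    (centralChoose (i + 1)).taylor 2 + (centralChoose (i + 1)).taylor (-2) =
      2 * centralChoose (i + 1) + centralChoose i := by
  refine Polynomial.funext fun x => ?_
  simp only [Polynomial.eval_add, Polynomial.eval_mul, Polynomial.taylor_eval,
    Polynomial.eval_ofNat, centralChoose_eval, factorial_two_mul_succ]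
  have h1 := descPochhammer_eval_sub_one (2 * i + 1) ((x - 1) / 2 + i + 2)
  have h2 := descPochhammer_eval_sub_one (2 * i + 1) ((x - 1) / 2 + i + 1)
  have h3 := descPochhammer_eval_sub_one (2 * i) ((x - 1) / 2 + i + 1)
  rw [show (x - 1) / 2 + (i : ℚ) + 2 - 1 = (x - 1) / 2 + i + 1 by ring] at h1
  rw [show (x - 1) / 2 + (i : ℚ) + 1 - 1 = (x - 1) / 2 + i by ring] at h2 h3
  rw [show 2 * (i + 1) = 2 * i + 1 + 1 by ring,
    show (x + 2 - 1) / 2 + ((i + 1 : ℕ) : ℚ) = (x - 1) / 2 + i + 2 by push_cast; ring,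
    show (x + -2 - 1) / 2 + ((i + 1 : ℕ) : ℚ) = (x - 1) / 2 + i by push_cast; ring,
    show (x - 1) / 2 + ((i + 1 : ℕ) : ℚ) = (x - 1) / 2 + i + 1 by push_cast; ring]
  have hf : ((2 * i).factorial : ℚ) ≠ 0 := by positivity
  have hi : (2 * (i : ℚ) + 1) ≠ 0 := by positivity
  have hi2 : (2 * (i : ℚ) + 2) ≠ 0 := by positivity
  push_cast at h1 h2 h3
  generalize (x - 1) / 2 + (i : ℚ) = y at *
  field_simp
  linear_combination h2 - h1 - (2 * i + 2) * h3

theorem descPochhammer_eval_add_one (n : ℕ) (x : ℚ) :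
    (descPochhammer ℚ (n + 2)).eval (x + 1) =
      (x + 1) * (x - n) * (descPochhammer ℚ n).eval x := by
  rw [descPochhammer_succ_left, Polynomial.eval_mul, Polynomial.eval_comp,
    descPochhammer_succ_right]
  simp
  ring

theorem X_sq_sub_one_mul_centralChoose (i : ℕ) :
    Polynomial.C (1 / 8) * (Polynomial.X ^ 2 - 1) * centralChoose i =
      (((2 * i + 1) * (i + 1) : ℕ) : ℚ) • centralChoose (i + 1) +
        ((i + 1).choose 2 : ℚ) • centralChoose i := by
  refine Polynomial.funext fun x => ?_
  simp only [Polynomial.eval_add, Polynomial.eval_mul, Polynomial.eval_smul, Polynomial.eval_C,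
    Polynomial.eval_sub, Polynomial.eval_pow, Polynomial.eval_X, Polynomial.eval_one, smul_eq_mul,
    centralChoose_eval, factorial_two_mul_succ, Nat.cast_choose_two]
  have h := descPochhammer_eval_add_one (2 * i) ((x - 1) / 2 + i)
  rw [show 2 * (i + 1) = 2 * i + 2 by ring,
    show (x - 1) / 2 + ((i + 1 : ℕ) : ℚ) = (x - 1) / 2 + i + 1 by push_cast; ring,
    h]
  have hf : ((2 * i).factorial : ℚ) ≠ 0 := by positivity
  have hi : (2 * (i : ℚ) + 1) ≠ 0 := by positivity
  have hi2 : (2 * (i : ℚ) + 2) ≠ 0 := by positivity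
  push_cast
  field_simp
  ring

theorem centralChoose_succ_eval_of_sq_eq_one (i : ℕ) (x : ℚ) (hx : x ^ 2 = 1) :
    (centralChoose (i + 1)).eval x = 0 := by
  induction i with
  | zero =>
    have h := congrArg (Polynomial.eval x) (X_sq_sub_one_mul_centralChoose 0)
    simpa [hx] using h.symm
  | succ i ih =>
    have h := congrArg (Polynomial.eval x) (X_sq_sub_one_mul_centralChoose (i + 1))
    simp only [Polynomial.eval_add, Polynomial.eval_mul, Polynomial.eval_smul, ih, mul_zero,
      add_zero, smul_eq_mul] at h
    exact (mul_eq_zero.1 h.symm).resolve_left (by positivity)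

theorem eulerFunctional_centralChoose (i : ℕ) :
    eulerFunctional (centralChoose i) = (-1) ^ i := by
  induction i with
  | zero =>
    rw [centralChoose_zero]
    have h := eulerFunctional_taylor 1
    simp at h
    simpa using h
  | succ i ih =>
    have h := eulerFunctional_taylor (centralChoose (i + 1))
    rw [← map_add, centralChoose_second_difference,
      centralChoose_succ_eval_of_sq_eq_one i 1 (by norm_num),
      centralChoose_succ_eval_of_sq_eq_one i (-1) (by norm_num), two_mul, map_add, map_add, ih] at h
    rw [pow_succ]
    linear_combination h

theorem eulerFunctional_pow_mul_centralChoose_mem_int (n i : ℕ) :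
    ∃ z : ℤ, eulerFunctional
      ((Polynomial.C (1 / 8) * (Polynomial.X ^ 2 - 1)) ^ n * centralChoose i) = z := by
  induction n generalizing i with
  | zero => exact ⟨(-1) ^ i, by simp [eulerFunctional_centralChoose]⟩
  | succ n ih =>
    obtain ⟨z, hz⟩ := ih (i + 1)
    obtain ⟨w, hw⟩ := ih i
    refine ⟨((2 * i + 1) * (i + 1) : ℕ) * z + (i + 1).choose 2 * w, ?_⟩
    rw [pow_succ, mul_assoc, X_sq_sub_one_mul_centralChoose, mul_add, mul_smul_comm,
      mul_smul_comm, map_add, map_smul, map_smul, hz, hw]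
    push_cast [smul_eq_mul]
    ring

theorem eulerFunctional_X_sq_sub_one_pow (n : ℕ) :
    ∃ z : ℤ, eulerFunctional ((Polynomial.X ^ 2 - 1) ^ n) = 8 ^ n * z := by
  obtain ⟨z, hz⟩ := eulerFunctional_pow_mul_centralChoose_mem_int n 0
  refine ⟨z, ?_⟩
  rw [← hz, centralChoose_zero, mul_one, mul_pow, ← map_pow, ← Polynomial.smul_eq_C_mul, map_smul,
    smul_eq_mul, ← mul_assoc, ← mul_pow]
  norm_num

/-- The Taylor polynomial at `1` of `u ^ k`, expanded in powers of `u`. -/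
theorem sum_alternating_choose_mul_pow {R : Type*} [CommRing R] (u : R) {k n : ℕ} (h : n ≤ k) :
    ∑ r ∈ Finset.range n,
        (-1) ^ (n - 1 - r) * ((k - 1 - r).choose (n - 1 - r) : R) * (k.choose r : R) * u ^ r =
      ∑ j ∈ Finset.range n, (k.choose j : R) * (u - 1) ^ j := by
  induction n with
  | zero => simp
  | succ n ih =>
    rw [Finset.sum_range_succ _ n, Finset.sum_range_succ _ n, ← ih (by omega), sub_eq_add_neg,
      add_pow, Finset.sum_range_succ, mul_add, ← add_assoc, Finset.mul_sum,
      ← Finset.sum_add_distrib]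
    congr 1
    · refine Finset.sum_congr rfl fun r hr => ?_
      obtain ⟨m, rfl⟩ := Nat.exists_eq_add_of_lt (Finset.mem_range.1 hr)
      obtain ⟨l, rfl⟩ := Nat.exists_eq_add_of_le h
      have hc := Nat.choose_mul (n := r + m + 1 + 1 + l) (k := r + m + 1) (s := r) (by omega)
      rw [show r + m + 1 + 1 + l - r = m + l + 1 + 1 by omega,
        show r + m + 1 - r = m + 1 by omega, Nat.choose_succ_succ] at hc
      rw [show r + m + 1 + 1 - 1 - r = m + 1 by omega, show r + m + 1 - 1 - r = m by omega,
        show r + m + 1 + 1 + l - 1 - r = m + l + 1 by omega,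
        show r + m + 1 - r = m + 1 by omega]
      have hc' := congrArg (Nat.cast : ℕ → R) hc
      push_cast at hc'
      linear_combination (-1) ^ m * u ^ r * hc'
    · simp

theorem ichoose_sub (k r j : ℕ) (h : r < k) :
    ichoose ((k : ℤ) - 1 - r) j = ((k - 1 - r).choose j : ℤ) := by
  rw [ichoose, if_pos (by omega), show ((k : ℤ) - 1 - r).toNat = k - 1 - r by omega]

theorem ichoose_neg_one (j : ℕ) : ichoose (-1) j = (-1) ^ j := by
  rw [ichoose, if_neg (by norm_num)]
  simp

theorem key_congruence_mod_two_pow_three_n (k : ℕ) (n : ℕ) (hn : 0 < n) :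
    ∃ q : ℚ, Odd q.den ∧
      ((3 ^ (2 * k + 1) + 1 : ℚ) / 4) * (eulerE (2 * k) : ℚ)
        - ∑ r ∈ Finset.range n, (-1 : ℚ) ^ (n - 1 - r) * (ichoose ((k : ℤ) - 1 - r) (n - 1 - r) : ℚ)
            * (k.choose r : ℚ) * ((3 ^ (2 * r + 1) + 1 : ℚ) / 4) * (eulerE (2 * r) : ℚ)
      = 2 ^ (3 * n) * q := by
  rcases le_or_gt n k with h | h
  · choose z hz using eulerFunctional_X_sq_sub_one_pow
    have hT : ∑ r ∈ Finset.range n, (-1 : ℚ) ^ (n - 1 - r) *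
        (ichoose ((k : ℤ) - 1 - r) (n - 1 - r) : ℚ) * (k.choose r : ℚ) *
          ((3 ^ (2 * r + 1) + 1 : ℚ) / 4) * (eulerE (2 * r) : ℚ) =
        ∑ j ∈ Finset.range n, (k.choose j : ℚ) * (8 ^ j * z j) := by
      have hp := congrArg eulerFunctional
        (sum_alternating_choose_mul_pow (Polynomial.X ^ 2 : Polynomial ℚ) h)
      rw [map_sum, map_sum] at hp
      convert hp using 2 with r hr j hj
      · rw [ichoose_sub k r _ (by have := Finset.mem_range.1 hr; omega), mul_assoc,
          ← eulerFunctional_X_pow_eq, ← pow_mul, ← smul_eq_mul, ← map_smul,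
          Polynomial.smul_eq_C_mul]
        simp
      · rw [← hz, ← smul_eq_mul, ← map_smul, Polynomial.smul_eq_C_mul, map_natCast]
    have hf : ((3 ^ (2 * k + 1) + 1 : ℚ) / 4) * (eulerE (2 * k) : ℚ) =
        ∑ j ∈ Finset.range (k + 1), (k.choose j : ℚ) * (8 ^ j * z j) := by
      rw [← eulerFunctional_X_pow_eq, pow_mul,
        ← sub_add_cancel (Polynomial.X ^ 2 : Polynomial ℚ) 1, add_pow, map_sum]
      refine Finset.sum_congr rfl fun j _ => ?_
      rw [← hz, ← smul_eq_mul (k.choose j : ℚ), ← map_smul, Polynomial.smul_eq_C_mul, map_natCast,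
        one_pow, mul_one, mul_comm]
    refine ⟨((∑ j ∈ Finset.Ico n (k + 1), k.choose j * (8 ^ (j - n) * z j) : ℤ) : ℚ), ?_, ?_⟩
    · rw [Rat.den_intCast]; exact odd_one
    · rw [hT, hf, ← Finset.sum_Ico_eq_sub _ (by omega), pow_mul, Int.cast_sum, Finset.mul_sum]
      refine Finset.sum_congr rfl fun j hj => ?_
      obtain ⟨m, rfl⟩ := Nat.exists_eq_add_of_le (Finset.mem_Ico.1 hj).1
      rw [Nat.add_sub_cancel_left, pow_add]
      push_cast
      ring
  · refine ⟨0, by simp, ?_⟩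
    rw [Finset.sum_eq_single_of_mem k (Finset.mem_range.2 h)]
    · rw [show (k : ℤ) - 1 - k = -1 by ring, ichoose_neg_one]
      push_cast
      rw [← mul_pow]
      simp
    · intro r _ hrk
      rcases lt_or_gt_of_ne hrk with hr | hr
      · rw [ichoose_sub k r _ hr, Nat.choose_eq_zero_of_lt (by omega)]
        simp
      · simp [Nat.choose_eq_zero_of_lt hr]
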